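/- Let t,n be positive integers, let P be a finite semipure poset of length n, and let λ_P : Cov(P̂) → L_P be an EL-labeling of P̂. Let λ be the EL-labeling of (P∗T_{t,n})^ obtained by applying the Rees-product EL-labeling construction to λ_P and the constant semi-EL-labeling of T_{t,n}. For m ∈ ℕ and a sequence w ∈ L_P^{m+2}, let c(w) be the number of maximal chains of P̂ of length m+2 with label sequence w. Then the number of ascent-free maximal chains of (P∗T_{t,n})^ of length m+2 equals the sum over all w ∈ L_P^{m+2} with no double ascent, w₁ ≰ w₂ and w_{m+1} ≰ w_{m+2} of c(w)·t^{asc(w)}(1+t)^{m−2·asc(w)}, plus the sum over all w ∈ L_P^{m+2} with no double ascent, w₁ ≰ w₂ and w_{m+1} ≤ w_{m+2} of c(w)·t^{asc(w)}(1+t)^{m+1−2·asc(w)}. -/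

import Mathlib

attribute [local instance] Classical.propDecidable

section Prelude

variable {α : Type*} {L : Type*}

/-- The cover relation within the subposet on the subset `s`. -/
def CovIn [PartialOrder α] (s : Set α) (a b : α) : Prop :=
  a ∈ s ∧ b ∈ s ∧ a < b ∧ ∀ c ∈ s, ¬(a < c ∧ c < b)

/-- `l` is a maximal chain of the subposet of `α` on the subset `s`:
a nonempty saturated chain starting at a minimal element of `s` and
ending at a maximal element of `s`. -/
def IsMaxChainIn [PartialOrder α] (s : Set α) (l : List α) : Prop :=
  l ≠ [] ∧ (∀ x ∈ l, x ∈ s) ∧ l.Chain' (CovIn s) ∧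
    (∀ x, l.head? = some x → ∀ c ∈ s, ¬c < x) ∧
    (∀ x, l.getLast? = some x → ∀ c ∈ s, ¬x < c)

/-- `l` is a maximal chain of the poset `α`. -/
def IsMaximalChain [PartialOrder α] (l : List α) : Prop :=
  IsMaxChainIn Set.univ l

/-- The poset `α` has length `n`, i.e. its longest chains have `n + 1` elements. -/
def HasLength (α : Type*) [PartialOrder α] (n : ℕ) : Prop :=
  (∃ l : List α, l.Chain' (· < ·) ∧ l.length = n + 1) ∧
    ∀ l : List α, l.Chain' (· < ·) → l.length ≤ n + 1

/-- `r` is a rank function for the poset `α`; the existence of such a function says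
exactly that `α` is semipure with rank function `r` (for every `x`, every maximal chain
of the lower order ideal `P_{≤ x}` has length `r x`, i.e. `r x + 1` elements). -/
def IsRankFunction [PartialOrder α] (r : α → ℕ) : Prop :=
  ∀ x : α, ∀ l : List α, IsMaxChainIn (Set.Iic x) l → l.length = r x + 1

/-- The label sequence of a chain `l` under the edge labeling `lab`. -/
def labelSeq (lab : α → α → L) (l : List α) : List L :=
  List.zipWith lab l l.tail

/-- `l` is a maximal (i.e. saturated) chain of the closed interval `[x, y]`. -/
def IsMaxChainOfInterval [PartialOrder α] (x y : α) (l : List α) : Prop :=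
  l.Chain' (· ⋖ ·) ∧ l.head? = some x ∧ l.getLast? = some y

/-- The EL-condition for the interval `[x, y]`: there is a unique maximal chain of
`[x, y]` with weakly increasing labels, and its label sequence strictly lexicographically
precedes the label sequence of any other maximal chain of `[x, y]`. -/
def ELCondition [PartialOrder α] [PartialOrder L] (lab : α → α → L) (x y : α) : Prop :=
  ∃ c : List α, IsMaxChainOfInterval x y c ∧ (labelSeq lab c).Chain' (· ≤ ·) ∧
    (∀ d : List α, IsMaxChainOfInterval x y d → (labelSeq lab d).Chain' (· ≤ ·) → d = c) ∧
    ∀ d : List α, IsMaxChainOfInterval x y d → d ≠ c →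
      List.Lex (· < ·) (labelSeq lab c) (labelSeq lab d)

/-- `lab` is an EL-labeling of the poset `α`. -/
def IsELLabeling [PartialOrder α] [PartialOrder L] (lab : α → α → L) : Prop :=
  ∀ x y : α, x ≤ y → ELCondition lab x y

/-- `lab` is a semi-EL-labeling of the poset `α` with minimum element: its restriction to
`[⊥, m]` is an EL-labeling for every maximal element `m`. -/
def IsSemiELLabeling [PartialOrder α] [OrderBot α] [PartialOrder L] (lab : α → α → L) : Prop :=
  ∀ m : α, IsMax m → ∀ x y : α, x ≤ y → y ≤ m → ELCondition lab x y

/-- The underlying set of the Rees product of two (semipure) posets with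
rank functions `rP`, `rQ`. -/
def Rees {α β : Type*} [PartialOrder α] [PartialOrder β] (rP : α → ℕ) (rQ : β → ℕ) : Type _ :=
  {x : α × β // rQ x.2 ≤ rP x.1}

/-- The Rees product order: `(p₁,q₁) ≤ (p₂,q₂)` iff `p₁ ≤ p₂`, `q₁ ≤ q₂` and the rank
increase in the first coordinate is at least the rank increase in the second coordinate. -/
instance Rees.instPartialOrder {α β : Type*} [PartialOrder α] [PartialOrder β]
    (rP : α → ℕ) (rQ : β → ℕ) : PartialOrder (Rees rP rQ) where
  le x y := x.1.1 ≤ y.1.1 ∧ x.1.2 ≤ y.1.2 ∧ rQ y.1.2 + rP x.1.1 ≤ rP y.1.1 + rQ x.1.2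
  le_refl x := ⟨le_rfl, le_rfl, by omega⟩
  le_trans x y z h₁ h₂ := ⟨h₁.1.trans h₂.1, h₁.2.1.trans h₂.2.1, by
    have := h₁.2.2; have := h₂.2.2; omega⟩
  le_antisymm x y h₁ h₂ := Subtype.ext
    (Prod.ext (le_antisymm h₁.1 h₂.1) (le_antisymm h₁.2.1 h₂.2.1))

/-- First (`P₁`) component of an element of `(P₁ ∗ P₂)^`, as an element of `P̂₁`;
the adjoined minimum goes to `0̂₁` and the adjoined maximum to `1̂₁`. -/
def reesFst {α β : Type*} [PartialOrder α] [PartialOrder β] {rP : α → ℕ} {rQ : β → ℕ}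
    (a : WithBot (WithTop (Rees rP rQ))) : WithBot (WithTop α) :=
  WithBot.recBotCoe ⊥
    (fun b => WithTop.recTopCoe (⊤ : WithBot (WithTop α))
      (fun z => ((z.1.1 : WithTop α) : WithBot (WithTop α))) b) a

/-- Second (`P₂`) component of an element of `(P₁ ∗ P₂)^`; the adjoined minimum is
identified with `(0̂₁, 0̂₂)`, so its second component is `0̂₂ = ⊥`. -/
def reesSnd {α β : Type*} [PartialOrder α] [PartialOrder β] [OrderBot β]
    {rP : α → ℕ} {rQ : β → ℕ} (a : WithBot (WithTop (Rees rP rQ))) : β :=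
  WithBot.recBotCoe ⊥ (fun b => WithTop.recTopCoe (⊥ : β) (fun z => z.1.2) b) a

/-- The Rees-product edge labeling of `(P₁ ∗ P₂)^` by the poset `L₁ × (L₂ ⊎ {0̂_{L₂}})`
(the product order, a new minimum `⊥` adjoined to `L₂`): a cover `((x,k),(y,l))` is
labeled `(λ₁(x,y), λ₂(k,l))` if `k < l`, and `(λ₁(x,y), 0̂_{L₂})` if `k = l`; a cover
`((x,k), 1̂)` of the top is labeled `(λ₁(x,1̂₁), 0̂_{L₂})`. -/
noncomputable def reesLab {α β L₁ L₂ : Type*} [PartialOrder α] [PartialOrder β] [OrderBot β]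
    [PartialOrder L₂] (rP : α → ℕ) (rQ : β → ℕ)
    (lab₁ : WithBot (WithTop α) → WithBot (WithTop α) → L₁) (lab₂ : β → β → L₂)
    (a b : WithBot (WithTop (Rees rP rQ))) : L₁ × WithBot L₂ :=
  (lab₁ (reesFst a) (reesFst b),
    if reesSnd a < reesSnd b then ((lab₂ (reesSnd a) (reesSnd b) : L₂) : WithBot L₂) else ⊥)

end Prelude

section Words

/-- `T_{t,n}`: the poset of sequences over `[t]` of length at most `n`,
ordered by the prefix order (a complete `t`-ary tree of height `n`, rooted at bottom). -/
def Ttn (t n : ℕ) : Type := {l : List (Fin t) // l.length ≤ n}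

instance (t n : ℕ) : PartialOrder (Ttn t n) where
  le x y := x.1 <+: y.1
  le_refl x := List.prefix_refl x.1
  le_trans _ _ _ h₁ h₂ := List.IsPrefix.trans h₁ h₂
  le_antisymm _ _ h₁ h₂ := Subtype.ext (List.IsPrefix.eq_of_length h₁
    (le_antisymm (List.IsPrefix.length_le h₁) (List.IsPrefix.length_le h₂)))

instance (t n : ℕ) : OrderBot (Ttn t n) where
  bot := ⟨[], by simp⟩
  bot_le x := show [] <+: x.1 from List.nil_prefix

/-- The rank function of `T_{t,n}` (its length as a sequence). -/
def rankT (t n : ℕ) (q : Ttn t n) : ℕ := q.1.length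

/-- A maximal chain is ascent free (w.r.t. the labeling `lab`) if no two consecutive
labels `a`, `b` on the chain satisfy `a ≤ b`. -/
def AscentFree {α L : Type*} [Preorder L] (lab : α → α → L) (l : List α) : Prop :=
  (labelSeq lab l).Chain' (fun a b => ¬a ≤ b)

/-- The number of ascents of the word `w = w₁ ⋯ w_m` over the poset `L`:
indices `i ∈ [m-1]` with `w_i ≤ w_{i+1}`. -/
noncomputable def ascF {L : Type*} [Preorder L] {m : ℕ} (w : Fin m → L) : ℕ :=
  (Finset.univ.filter fun i : Fin (m - 1) =>
      w ⟨(i : ℕ), by have := i.2; omega⟩ ≤ w ⟨(i : ℕ) + 1, by have := i.2; omega⟩).card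

/-- The word `w = w₁ ⋯ w_m` over the poset `L` has no double ascent
(no `i` with `w_i ≤ w_{i+1} ≤ w_{i+2}`). -/
def NDAF {L : Type*} [Preorder L] {m : ℕ} (w : Fin m → L) : Prop :=
  ∀ i : ℕ, ∀ h : i + 2 < m,
    ¬(w ⟨i, by omega⟩ ≤ w ⟨i + 1, by omega⟩ ∧ w ⟨i + 1, by omega⟩ ≤ w ⟨i + 2, h⟩)

end Words

set_option linter.unusedSectionVars false

section RankLemmas

variable {α : Type*} [PartialOrder α]

theorem covIn_univ_iff {a b : α} : CovIn Set.univ a b ↔ a ⋖ b := by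
  constructor
  · rintro ⟨-, -, h, h'⟩
    exact ⟨h, fun c h1 h2 => h' c trivial ⟨h1, h2⟩⟩
  · rintro ⟨h, h'⟩
    exact ⟨trivial, trivial, h, fun c _ hc => h' hc.1 hc.2⟩

theorem maxChain_snoc {x y : α} (h : y ⋖ x) {l : List α}
    (hl : IsMaxChainIn (Set.Iic y) l) : IsMaxChainIn (Set.Iic x) (l ++ [x]) := by
  obtain ⟨h1, h2, h3, h4, h5⟩ := hl
  refine ⟨by simp, ?_, ?_, ?_, ?_⟩
  · intro z hz
    simp only [List.mem_append, List.mem_singleton] at hz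
    rcases hz with hz | rfl
    · exact (h2 z hz).trans h.le
    · exact le_refl _
  · refine List.isChain_append.2 ⟨?_, by simp, ?_⟩
    · refine List.IsChain.imp ?_ h3
      rintro a b ⟨ha, hb, hab, hc⟩
      refine ⟨le_trans ha h.le, le_trans hb h.le, hab, fun c _ hc' => hc c ?_ hc'⟩
      exact le_trans hc'.2.le hb
    · intro a ha b hb
      simp only [List.head?_cons, Option.mem_def, Option.some.injEq] at hb
      subst hb
      have hay : a = y := by
        have ha' := h2 a (List.mem_of_getLast? ha)
        by_contra hne
        exact h5 a ha y (le_refl y) (lt_of_le_of_ne ha' hne)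
      subst hay
      exact ⟨h.le, le_refl _, h.lt, fun c _ hc => h.2 hc.1 hc.2⟩
  · intro z hz c hc hcz
    have : l.head? = some z := by
      cases l with
      | nil => exact absurd rfl h1
      | cons a l => simpa using hz
    exact h4 z this c (hcz.le.trans (h2 z (List.mem_of_head? this))) hcz
  · intro z hz c hc hcz
    simp at hz
    subst hz
    exact absurd hcz (not_lt_of_ge hc)

theorem exists_maxChain [Finite α] (x : α) : ∃ l, IsMaxChainIn (Set.Iic x) l := by
  induction x using WellFoundedLT.induction with
  | _ x ih =>
    by_cases hx : IsMin x
    · refine ⟨[x], by simp, by simp, by simp [List.Chain'], ?_, ?_⟩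
      · intro y hy c _ hc
        simp at hy
        subst hy
        exact hx.not_lt hc
      · intro y hy c hc hc'
        simp at hy
        subst hy
        exact absurd hc' (not_lt_of_ge hc)
    · rw [not_isMin_iff] at hx
      obtain ⟨y, hy⟩ := hx
      obtain ⟨z, -, hz⟩ := exists_le_covBy_of_lt hy
      obtain ⟨l, hl⟩ := ih z hz.lt
      exact ⟨_, maxChain_snoc hz hl⟩

variable [Finite α] {rP : α → ℕ}

theorem rank_cov (hrP : IsRankFunction rP) {x y : α} (h : y ⋖ x) : rP x = rP y + 1 := by
  obtain ⟨l, hl⟩ := exists_maxChain y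
  have h1 := hrP _ _ hl
  have h2 := hrP _ _ (maxChain_snoc h hl)
  simp at h2
  omega

theorem rank_lt (hrP : IsRankFunction rP) {x y : α} (h : x < y) : rP x < rP y := by
  induction y using WellFoundedLT.induction with
  | _ y ih =>
    obtain ⟨z, hz, hzy⟩ := exists_le_covBy_of_lt h
    have h2 := rank_cov hrP hzy
    rcases hz.lt_or_eq with h3 | h3
    · have := ih z hzy.lt h3
      omega
    · subst h3
      omega

theorem rank_isMin (hrP : IsRankFunction rP) {x : α} (h : IsMin x) : rP x = 0 := by
  have : IsMaxChainIn (Set.Iic x) [x] := by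
    refine ⟨by simp, by simp, by simp [List.Chain'], ?_, ?_⟩
    · intro y hy c _ hc
      simp at hy
      subst hy
      exact h.not_lt hc
    · intro y hy c hc hc'
      simp at hy
      subst hy
      exact absurd hc' (not_lt_of_ge hc)
  simpa using (hrP _ _ this).symm

theorem rank_le_length (hrP : IsRankFunction rP) {n : ℕ} (hlen : HasLength α n) (x : α) : rP x ≤ n := by
  obtain ⟨l, hl⟩ := exists_maxChain x
  have h1 := hrP _ _ hl
  have h2 := hlen.2 l (List.IsChain.imp (fun a b h => h.2.2.1) hl.2.2.1)
  omega

end RankLemmas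

section ReesCov

variable {α : Type*} [PartialOrder α] [Finite α] {rP : α → ℕ} {t n : ℕ}

theorem Rees.le_def' (x y : Rees rP (rankT t n)) : x ≤ y ↔ x.1.1 ≤ y.1.1 ∧ x.1.2 ≤ y.1.2 ∧
    rankT t n y.1.2 + rP x.1.1 ≤ rP y.1.1 + rankT t n x.1.2 := Iff.rfl

theorem Ttn.le_def' (x y : Ttn t n) : x ≤ y ↔ x.1 <+: y.1 := Iff.rfl

theorem Rees.fst_lt {x y : Rees rP (rankT t n)} (h : x < y) : x.1.1 < y.1.1 := by
  obtain ⟨h1, h2, h3⟩ := h.le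
  refine lt_of_le_of_ne h1 fun he => ?_
  refine h.ne (Subtype.ext (Prod.ext he (Subtype.ext (List.IsPrefix.eq_of_length h2 ?_))))
  have := List.IsPrefix.length_le h2
  rw [he] at h3
  simp only [rankT] at h3
  omega

theorem Rees.covBy_iff (hrP : IsRankFunction rP) {x y : Rees rP (rankT t n)} :
    x ⋖ y ↔ x.1.1 ⋖ y.1.1 ∧ (y.1.2 = x.1.2 ∨ ∃ i, y.1.2.1 = x.1.2.1 ++ [i]) := by
  constructor
  · intro h
    obtain ⟨h1, h2, h3⟩ := h.le
    have hlt := Rees.fst_lt h.lt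
    have hcov : x.1.1 ⋖ y.1.1 := by
      refine ⟨hlt, fun p hp1 hp2 => ?_⟩
      have r1 := rank_lt hrP hp1
      have r2 := rank_lt hrP hp2
      have hx := x.2
      have hl := List.IsPrefix.length_le h2
      have hyn := y.1.2.2
      simp only [rankT] at h3 hx
      let k := min y.1.2.1.length (x.1.2.1.length + (rP p - rP x.1.1))
      have hk : (y.1.2.1.take k).length = k := by
        simp [k]
      let z : Rees rP (rankT t n) := ⟨(p, ⟨y.1.2.1.take k, by omega⟩), by
        simp only [rankT, hk]; omega⟩
      have hxz : x < z := by
        refine lt_of_le_of_ne ⟨hp1.le, ?_, ?_⟩ (fun he => hp1.ne (by rw [he]))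
        · refine List.prefix_of_prefix_length_le h2 (List.take_prefix _ _) ?_
          simp only [z, hk]; omega
        · simp only [rankT, z, hk]; omega
      have hzy : z < y := by
        refine lt_of_le_of_ne ⟨hp2.le, ?_, ?_⟩ (fun he => hp2.ne (by rw [← he]))
        · exact List.take_prefix _ _
        · simp only [rankT, z, hk]; omega
      exact h.2 hxz hzy
    refine ⟨hcov, ?_⟩
    have hr := rank_cov hrP hcov
    obtain ⟨s, hs⟩ := h2
    simp only [rankT, ← hs, List.length_append] at h3
    match s, hs with
    | [], hs => left; exact Subtype.ext (by simpa using hs.symm)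
    | [i], hs => right; exact ⟨i, hs.symm⟩
    | _ :: _ :: _, hs => simp at h3; omega
  · rintro ⟨h1, h2⟩
    have hr := rank_cov hrP h1
    refine ⟨lt_of_le_of_ne ⟨h1.le, ?_, ?_⟩ (fun he => h1.lt.ne (by rw [he])), ?_⟩
    · rcases h2 with h2 | ⟨i, h2⟩
      · rw [h2]
      · rw [Ttn.le_def', h2]; simp
    · rcases h2 with h2 | ⟨i, h2⟩
      · rw [h2]; omega
      · simp only [rankT, h2, List.length_append, List.length_singleton]; omega
    · intro z hz1 hz2
      exact h1.2 (Rees.fst_lt hz1) (Rees.fst_lt hz2)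

theorem Rees.isMin_iff (hrP : IsRankFunction rP) {x : Rees rP (rankT t n)} :
    IsMin x ↔ IsMin x.1.1 := by
  constructor
  · intro h
    by_contra hx
    obtain ⟨p, hp⟩ := not_isMin_iff.1 hx
    have r := rank_lt hrP hp
    have hx2 := x.2
    simp only [rankT] at hx2
    let z : Rees rP (rankT t n) := ⟨(p, ⟨x.1.2.1.take (rP p), by
      have := x.1.2.2; simp; omega⟩), by simp [rankT]⟩
    have hz : z ≤ x := by
      refine ⟨hp.le, List.take_prefix _ _, ?_⟩
      simp only [rankT, z, List.length_take]
      omega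
    have : x.1.1 ≤ p := (h hz).1
    exact absurd hp (not_lt_of_ge this)
  · intro h z hz
    by_contra hn
    exact h.not_lt (Rees.fst_lt (lt_of_le_not_ge hz hn))

theorem Rees.isMax_iff (hrP : IsRankFunction rP) {x : Rees rP (rankT t n)} :
    IsMax x ↔ IsMax x.1.1 := by
  constructor
  · intro h
    by_contra hx
    obtain ⟨p, hp⟩ := not_isMax_iff.1 hx
    have r := rank_lt hrP hp
    have hx2 := x.2
    let z : Rees rP (rankT t n) := ⟨(p, x.1.2), by dsimp; omega⟩
    have hz : x ≤ z := by
      refine ⟨hp.le, le_refl _, ?_⟩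
      simp only [z]
      omega
    have : p ≤ x.1.1 := (h hz).1
    exact absurd hp (not_lt_of_ge this)
  · intro h z hz
    by_contra hn
    exact h.not_lt (Rees.fst_lt (lt_of_le_not_ge hz hn))

end ReesCov

section HatCov

/-- The embedding of a poset in its bounded extension. -/
abbrev hatc {α : Type*} (x : α) : WithBot (WithTop α) := ((x : WithTop α) : WithBot (WithTop α))

theorem hat_cases {α : Type*} [PartialOrder α] (x : WithBot (WithTop α)) :
    x = ⊥ ∨ x = ⊤ ∨ ∃ y, x = hatc y := by
  induction x using WithBot.recBotCoe with
  | bot => exact Or.inl rfl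
  | coe x =>
    induction x using WithTop.recTopCoe with
    | top => exact Or.inr (Or.inl rfl)
    | coe y => exact Or.inr (Or.inr ⟨y, rfl⟩)

variable {α : Type*} [PartialOrder α]

theorem hat_covBy {x y : α} : hatc x ⋖ hatc y ↔ x ⋖ y := by
  rw [WithBot.coe_covBy_coe, WithTop.coe_covBy_coe]

theorem hat_bot_covBy {x : α} : ⊥ ⋖ hatc x ↔ IsMin x := by
  rw [WithBot.bot_covBy_coe]
  constructor
  · intro h y hy
    exact WithTop.coe_le_coe.1 (h (WithTop.coe_le_coe.2 hy))
  · intro h y hy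
    induction y using WithTop.recTopCoe with
    | top => exact absurd hy (by simp)
    | coe y => exact WithTop.coe_le_coe.2 (h (WithTop.coe_le_coe.1 hy))

theorem hat_covBy_top {x : α} : hatc x ⋖ ⊤ ↔ IsMax x := by
  have : (⊤ : WithBot (WithTop α)) = ((⊤ : WithTop α) : WithBot (WithTop α)) := rfl
  rw [this, WithBot.coe_covBy_coe, WithTop.coe_covBy_top]

theorem hat_not_bot_covBy_top [h : Nonempty α] : ¬ ((⊥ : WithBot (WithTop α)) ⋖ ⊤) := by
  obtain ⟨x⟩ := h
  intro h
  refine h.2 (c := hatc x) (WithBot.bot_lt_coe _) ?_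
  exact WithBot.coe_lt_coe.2 (WithTop.coe_lt_top _)

end HatCov

section ReesHat

variable {α : Type*} [PartialOrder α] [Finite α] {rP : α → ℕ} {t n : ℕ}

@[simp] theorem reesFst_bot : reesFst (⊥ : WithBot (WithTop (Rees rP (rankT t n)))) = ⊥ := rfl
@[simp] theorem reesFst_top : reesFst (⊤ : WithBot (WithTop (Rees rP (rankT t n)))) = ⊤ := rfl
@[simp] theorem reesFst_hatc (z : Rees rP (rankT t n)) : reesFst (hatc z) = hatc z.1.1 := rfl
@[simp] theorem reesSnd_bot : reesSnd (⊥ : WithBot (WithTop (Rees rP (rankT t n)))) = ⊥ := rfl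
@[simp] theorem reesSnd_top : reesSnd (⊤ : WithBot (WithTop (Rees rP (rankT t n)))) = ⊥ := rfl
@[simp] theorem reesSnd_hatc (z : Rees rP (rankT t n)) : reesSnd (hatc z) = z.1.2 := rfl

theorem hat_top_not_covBy {β : Type*} [PartialOrder β] {x : WithBot (WithTop β)} : ¬ ⊤ ⋖ x :=
  fun h => not_top_lt h.lt

theorem reesFst_eq_bot {x : WithBot (WithTop (Rees rP (rankT t n)))} :
    reesFst x = ⊥ ↔ x = ⊥ := by
  rcases hat_cases x with rfl | rfl | ⟨y, rfl⟩
  · simp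
  · simp
  · simp

theorem hatc_ne_top {β : Type*} [PartialOrder β] (y : β) : hatc y ≠ ⊤ := by
  intro h
  have := WithBot.coe_injective (h : _ = ((⊤ : WithTop β) : WithBot (WithTop β)))
  exact WithTop.coe_ne_top this

theorem reesFst_eq_top {x : WithBot (WithTop (Rees rP (rankT t n)))} :
    reesFst x = ⊤ ↔ x = ⊤ := by
  rcases hat_cases x with rfl | rfl | ⟨y, rfl⟩
  · simp
  · simp
  · exact iff_of_false (hatc_ne_top _) (hatc_ne_top _)

theorem reesFst_covBy [Nonempty α] (hrP : IsRankFunction rP)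
    {x y : WithBot (WithTop (Rees rP (rankT t n)))} (h : x ⋖ y) :
    reesFst x ⋖ reesFst y := by
  have : Nonempty (Rees rP (rankT t n)) := by
    obtain ⟨p⟩ := ‹Nonempty α›
    exact ⟨⟨(p, ⊥), by simp only [rankT]; exact Nat.zero_le _⟩⟩
  rcases hat_cases x with rfl | rfl | ⟨x, rfl⟩
  · rcases hat_cases y with rfl | rfl | ⟨y, rfl⟩
    · exact absurd h.lt (lt_irrefl _)
    · exact absurd h hat_not_bot_covBy_top
    · exact hat_bot_covBy.2 ((Rees.isMin_iff hrP).1 (hat_bot_covBy.1 h))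
  · exact absurd h hat_top_not_covBy
  · rcases hat_cases y with rfl | rfl | ⟨y, rfl⟩
    · exact absurd h.lt not_lt_bot
    · exact hat_covBy_top.2 ((Rees.isMax_iff hrP).1 (hat_covBy_top.1 h))
    · exact hat_covBy.2 ((Rees.covBy_iff hrP).1 (hat_covBy.1 h)).1

end ReesHat

section Counting

universe u

/-- The label bit of a step. -/
def bitLab (b : Bool) : WithBot PUnit.{u + 1} :=
  if b then ((PUnit.unit : PUnit.{u + 1}) : WithBot PUnit.{u + 1}) else ⊥

theorem bit_le {L : Type*} [PartialOrder L] (a w : L) (b c : Bool) :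
    (a, bitLab.{u} b) ≤ (w, bitLab.{u} c) ↔ a ≤ w ∧ (b = true → c = true) := by
  rw [Prod.mk_le_mk]
  cases b <;> cases c <;> simp [bitLab]

/-- Weighted number of ways to complete a label word to an ascent free word. -/
noncomputable def cntG {L : Type*} [PartialOrder L] (t : ℕ) : Bool → L → List L → ℕ
  | _, _, [] => 0
  | b, a, [w] => if a ≤ w ∧ (b = true → false = true) then 0 else 1
  | b, a, w :: w' :: ws =>
      (if a ≤ w ∧ (b = true → false = true) then 0 else cntG t false w (w' :: ws)) +
      t * (if a ≤ w ∧ (b = true → true = true) then 0 else cntG t true w (w' :: ws))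

variable {α : Type*} [PartialOrder α] [Finite α] {rP : α → ℕ} {t n : ℕ}

/-- The fiber of Rees chains above a chain, continuing after `z`. -/
def Fib {L : Type*} [PartialOrder L] (rP : α → ℕ) (t n : ℕ)
    (lab : WithBot (WithTop α) → WithBot (WithTop α) → L)
    (z : Rees rP (rankT t n)) (a : L) (b : Bool) (cs : List (WithBot (WithTop α))) : Type _ :=
  {l : List (WithBot (WithTop (Rees rP (rankT t n)))) //
    l.map reesFst = cs ∧ List.IsChain (· ⋖ ·) (hatc z :: l) ∧
    List.IsChain (fun a b => ¬ a ≤ b) ((a, bitLab.{u} b) ::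
      labelSeq (reesLab rP (rankT t n) lab (fun _ _ => (PUnit.unit : PUnit.{u + 1}))) (hatc z :: l))}

/-- Extension of a tree node. -/
def extNode (hrP : IsRankFunction rP) (hlen : HasLength α n) (z : Rees rP (rankT t n)) (p : α)
    (h : z.1.1 ⋖ p) : Option (Fin t) → Rees rP (rankT t n)
  | none => ⟨(p, z.1.2), by
      have := rank_cov hrP h
      have := z.2
      dsimp; omega⟩
  | some i => ⟨(p, ⟨z.1.2.1 ++ [i], by
      have := rank_cov hrP h
      have := rank_le_length hrP hlen p
      have := z.2
      simp only [rankT] at this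
      simp; omega⟩), by
      have := rank_cov hrP h
      have := z.2
      simp only [rankT] at this ⊢
      simp; omega⟩

theorem ext_fst (hrP : IsRankFunction rP) (hlen : HasLength α n) (z : Rees rP (rankT t n)) (p : α)
    (h : z.1.1 ⋖ p) (i) : (extNode hrP hlen z p h i).1.1 = p := by
  cases i <;> rfl

theorem ext_cov (hrP : IsRankFunction rP) (hlen : HasLength α n) (z : Rees rP (rankT t n)) (p : α)
    (h : z.1.1 ⋖ p) (i) : z ⋖ extNode hrP hlen z p h i := by
  rw [Rees.covBy_iff hrP, ext_fst]
  refine ⟨h, ?_⟩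
  cases i with
  | none => left; rfl
  | some i => right; exact ⟨i, rfl⟩

theorem ext_inj (hrP : IsRankFunction rP) (hlen : HasLength α n) (z : Rees rP (rankT t n)) (p : α)
    (h : z.1.1 ⋖ p) : Function.Injective (extNode hrP hlen z p h) := by
  intro i j hij
  have : (extNode hrP hlen z p h i).1.2.1 = (extNode hrP hlen z p h j).1.2.1 := by rw [hij]
  cases i <;> cases j <;> simp [extNode] at this ⊢
  exact this

theorem ext_surj (hrP : IsRankFunction rP) (hlen : HasLength α n) (z : Rees rP (rankT t n)) (p : α)
    (h : z.1.1 ⋖ p) (y : Rees rP (rankT t n)) (hy : z ⋖ y) (hp : y.1.1 = p) :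
    ∃ i, y = extNode hrP hlen z p h i := by
  rcases ((Rees.covBy_iff hrP).1 hy).2 with h2 | ⟨i, h2⟩
  · exact ⟨none, Subtype.ext (Prod.ext hp h2)⟩
  · exact ⟨some i, Subtype.ext (Prod.ext hp (Subtype.ext h2))⟩

theorem lab_ext {L : Type*} [PartialOrder L] (hrP : IsRankFunction rP) (hlen : HasLength α n)
    (lab : WithBot (WithTop α) → WithBot (WithTop α) → L) (z : Rees rP (rankT t n)) (p : α)
    (h : z.1.1 ⋖ p) (i) :
    reesLab rP (rankT t n) lab (fun _ _ => (PUnit.unit : PUnit.{u + 1})) (hatc z)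
      (hatc (extNode hrP hlen z p h i)) = (lab (hatc z.1.1) (hatc p), bitLab i.isSome) := by
  unfold reesLab
  refine Prod.ext ?_ ?_
  · simp [ext_fst]
  · cases i with
    | none =>
      have : ¬ z.1.2 < (extNode hrP hlen z p h none).1.2 := lt_irrefl _
      simp [bitLab, this]
    | some i =>
      have : z.1.2 < (extNode hrP hlen z p h (some i)).1.2 := by
        refine lt_of_le_of_ne (by rw [Ttn.le_def']; simp [extNode]) (fun he => ?_)
        have := congrArg (fun q : Ttn t n => q.1.length) he
        simp [extNode] at this
      simp [bitLab, this]

theorem lab_top {L : Type*} [PartialOrder L] 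
    (lab : WithBot (WithTop α) → WithBot (WithTop α) → L) (z : Rees rP (rankT t n)) :
    reesLab rP (rankT t n) lab (fun _ _ => (PUnit.unit : PUnit.{u + 1})) (hatc z) ⊤ =
      (lab (hatc z.1.1) ⊤, bitLab false) := by
  unfold reesLab
  refine Prod.ext ?_ ?_
  · simp
  · simp [bitLab]

theorem lab_bot {L : Type*} [PartialOrder L]
    (lab : WithBot (WithTop α) → WithBot (WithTop α) → L) (z : Rees rP (rankT t n))
    (hz : z.1.2 = ⊥) :
    reesLab rP (rankT t n) lab (fun _ _ => (PUnit.unit : PUnit.{u + 1})) ⊥ (hatc z) =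
      (lab ⊥ (hatc z.1.1), bitLab false) := by
  unfold reesLab
  refine Prod.ext ?_ ?_
  · simp
  · simp [bitLab, hz]

theorem labelSeq_cons_cons {X L : Type*} (lab : X → X → L) (x y : X) (l : List X) :
    labelSeq lab (x :: y :: l) = lab x y :: labelSeq lab (y :: l) := rfl

instance : Finite (Ttn t n) := (List.finite_length_le (Fin t) n).to_subtype

instance : Finite (Rees rP (rankT t n)) := by
  unfold Rees; infer_instance

theorem finite_lists (X : Type*) [Finite X] (Q : List X → Prop) (k : ℕ)
    (h : ∀ l, Q l → l.length = k) : Finite {l // Q l} :=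
  ((List.finite_length_eq X k).subset h).to_subtype

instance {L : Type*} [PartialOrder L]
    (lab : WithBot (WithTop α) → WithBot (WithTop α) → L)
    (z : Rees rP (rankT t n)) (a : L) (b : Bool) (cs : List (WithBot (WithTop α))) :
    Finite (Fib.{u} rP t n lab z a b cs) := by
  have : Finite (WithBot (WithTop (Rees rP (rankT t n)))) :=
    inferInstanceAs (Finite (Option (Option _)))
  refine finite_lists _ _ cs.length ?_
  rintro l ⟨rfl, -⟩
  simp

theorem card_fib {L : Type*} [PartialOrder L] (hrP : IsRankFunction rP) (hlen : HasLength α n)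
    (lab : WithBot (WithTop α) → WithBot (WithTop α) → L)
    (cs : List (WithBot (WithTop α))) :
    ∀ (z : Rees rP (rankT t n)) (a : L) (b : Bool),
    List.IsChain (· ⋖ ·) (hatc z.1.1 :: cs) → cs.getLast? = some ⊤ →
    Nat.card (Fib.{u} rP t n lab z a b cs) = cntG t b a (labelSeq lab (hatc z.1.1 :: cs)) := by
  induction cs with
  | nil => intro z a b _ h; simp at h
  | cons c cs ih =>
    intro z a b hch hlast
    rw [List.isChain_cons_cons] at hch
    cases cs with
    | nil =>
      simp at hlast
      subst hlast
      show _ = (if a ≤ lab (hatc z.1.1) ⊤ ∧ (b = true → false = true) then 0 else 1)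
      simp only [← bit_le.{u}]
      have hz : hatc z ⋖ ⊤ := by
        rw [hat_covBy_top, Rees.isMax_iff hrP, ← hat_covBy_top]; exact hch.1
      have hsub : ∀ l : List (WithBot (WithTop (Rees rP (rankT t n)))),
          l.map reesFst = [⊤] → l = [⊤] := by
        intro l hl
        obtain ⟨x, rfl, hx⟩ := List.map_eq_singleton_iff.1 hl
        rw [reesFst_eq_top] at hx
        rw [hx]
      split_ifs with hle
      · have : IsEmpty (Fib.{u} rP t n lab z a b [⊤]) := by
          refine ⟨?_⟩
          rintro ⟨l, h1, h2, h3⟩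
          have := hsub l h1
          subst this
          rw [labelSeq_cons_cons, List.isChain_cons_cons, lab_top] at h3
          exact h3.1 hle
        exact Nat.card_of_isEmpty
      · rw [Nat.card_eq_one_iff_unique]
        refine ⟨⟨fun x y => Subtype.ext ((hsub _ x.2.1).trans (hsub _ y.2.1).symm)⟩, ?_⟩
        refine ⟨⟨[⊤], by simp, by simpa using hz, ?_⟩⟩
        rw [labelSeq_cons_cons, List.isChain_cons_cons, lab_top]
        exact ⟨hle, by simp [labelSeq]⟩
    | cons d cs =>
      obtain ⟨p, rfl⟩ : ∃ p, c = hatc p := by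
        rcases hat_cases c with rfl | rfl | h
        · exact absurd hch.1.lt not_lt_bot
        · exact absurd (List.isChain_cons_cons.1 hch.2).1 hat_top_not_covBy
        · exact h
      have hzp : z.1.1 ⋖ p := hat_covBy.1 hch.1
      let e := extNode hrP hlen z p hzp
      have hlast' : (d :: cs).getLast? = some ⊤ := by simpa using hlast
      let F : (i : Option (Fin t)) → Type _ := fun i =>
        {_x : Fib.{u} rP t n lab (e i) (lab (hatc z.1.1) (hatc p)) i.isSome (d :: cs) //
          ¬ (a, bitLab.{u} b) ≤ (lab (hatc z.1.1) (hatc p), bitLab.{u} i.isSome)}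
      let f : (Σ i, F i) → Fib.{u} rP t n lab z a b (hatc p :: d :: cs) := fun x =>
        ⟨hatc (e x.1) :: x.2.1.1, by
          obtain ⟨i, ⟨l, h1, h2, h3⟩, h4⟩ := x
          refine ⟨?_, ?_, ?_⟩
          · simp only [List.map_cons, reesFst_hatc, h1]
            simp only [e, ext_fst]
          · rw [List.isChain_cons_cons]
            exact ⟨hat_covBy.2 (ext_cov _ _ _ _ _ _), h2⟩
          · rw [labelSeq_cons_cons, List.isChain_cons_cons, lab_ext]
            exact ⟨h4, h3⟩⟩
      have hf : Function.Bijective f := by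
        constructor
        · rintro ⟨i, ⟨l, h1⟩, h2⟩ ⟨j, ⟨l', h1'⟩, h2'⟩ h
          have h' := congrArg Subtype.val h
          simp only [f, List.cons.injEq] at h'
          obtain ⟨ha, hb⟩ := h'
          have ha' := WithTop.coe_injective (WithBot.coe_injective ha)
          have := ext_inj _ _ _ _ _ ha'
          subst this
          subst hb
          rfl
        · rintro ⟨l, h1, h2, h3⟩
          obtain ⟨y, l, rfl, hy, hl⟩ := List.map_eq_cons_iff.1 h1
          rw [List.isChain_cons_cons] at h2
          obtain ⟨y, rfl⟩ : ∃ y', y = hatc y' := by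
            rcases hat_cases y with rfl | rfl | h
            · exact absurd h2.1.lt not_lt_bot
            · exact absurd hy.symm (hatc_ne_top _)
            · exact h
          have hy' : y.1.1 = p := WithTop.coe_injective (WithBot.coe_injective hy)
          obtain ⟨i, rfl⟩ := ext_surj hrP hlen z p hzp y (hat_covBy.1 h2.1) hy'
          rw [labelSeq_cons_cons, List.isChain_cons_cons, lab_ext] at h3
          exact ⟨⟨i, ⟨⟨l, hl, h2.2, h3.2⟩, h3.1⟩⟩, rfl⟩
      rw [← Nat.card_congr (Equiv.ofBijective f hf), Nat.card_sigma]
      have hF : ∀ i, Nat.card (F i) =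
          if (a, bitLab.{u} b) ≤ (lab (hatc z.1.1) (hatc p), bitLab.{u} i.isSome) then 0 else
            cntG t i.isSome (lab (hatc z.1.1) (hatc p)) (labelSeq lab (hatc p :: d :: cs)) := by
        intro i
        have hi := ih (e i) (lab (hatc z.1.1) (hatc p)) i.isSome
          (by simp only [e, ext_fst]; exact hch.2) hlast'
        simp only [e, ext_fst] at hi
        split_ifs with hle
        · have : IsEmpty (F i) := ⟨fun x => x.2 hle⟩
          exact Nat.card_of_isEmpty
        · rw [← hi]
          exact Nat.card_congr (Equiv.subtypeUnivEquiv (fun _ => hle))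
      rw [Fintype.sum_option]
      simp only [hF, Option.isSome_none, Option.isSome_some, Finset.sum_const, Finset.card_univ,
        Fintype.card_fin, smul_eq_mul, bit_le]
      show _ = cntG t b a (_ :: _ :: labelSeq lab (d :: cs))
      rw [cntG]
      simp [labelSeq_cons_cons]

end Counting

section ClosedForm

variable {L : Type*} [PartialOrder L]

theorem ascF_succ {k : ℕ} (w : Fin (k + 3) → L) :
    ascF w = (if w 0 ≤ w 1 then 1 else 0) + ascF (Fin.tail w) := by
  unfold ascF
  rw [Finset.card_filter, Finset.card_filter]
  exact Fin.sum_univ_succ (n := k + 1) _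

theorem ndaF_succ {k : ℕ} (w : Fin (k + 3) → L) :
    NDAF w ↔ ¬ (w 0 ≤ w 1 ∧ w 1 ≤ w 2) ∧ NDAF (Fin.tail w) := by
  constructor
  · intro h
    refine ⟨h 0 (by omega), fun i hi => h (i + 1) (by omega)⟩
  · rintro ⟨h1, h2⟩ i hi
    cases i with
    | zero => exact h1
    | succ i => exact h2 i (by omega)

theorem cntG_closed (t k : ℕ) : ∀ (w : Fin (k + 2) → L),
    (¬ NDAF w → ∀ b, cntG t b (w 0) (List.ofFn (Fin.tail w)) = 0) ∧
    (w 0 ≤ w 1 → cntG t false (w 0) (List.ofFn (Fin.tail w)) = 0) ∧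
    (NDAF w → ¬ w 0 ≤ w 1 → ∃ e, e + 2 * ascF w =
        k + (if w ⟨k, by omega⟩ ≤ w ⟨k + 1, by omega⟩ then 1 else 0) ∧
        ∀ b, cntG t b (w 0) (List.ofFn (Fin.tail w)) = t ^ ascF w * (1 + t) ^ e) ∧
    (NDAF w → w 0 ≤ w 1 → ∃ e B, ascF w = B + 1 ∧ e + 2 * ascF w =
        k + 1 + (if w ⟨k, by omega⟩ ≤ w ⟨k + 1, by omega⟩ then 1 else 0) ∧
        cntG t true (w 0) (List.ofFn (Fin.tail w)) = t ^ B * (1 + t) ^ e) := by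
  induction k with
  | zero =>
    intro w
    have hl : List.ofFn (Fin.tail w) = [w 1] := by simp [Fin.tail]
    have hn : NDAF w := fun i hi => by omega
    have ha : ascF w = if w 0 ≤ w 1 then 1 else 0 := by
      unfold ascF
      rw [Finset.card_filter]
      exact Fin.sum_univ_one _
    rw [hl, ha]
    refine ⟨fun h => absurd hn h, ?_, ?_, ?_⟩
    · intro h
      simp [cntG, h]
    · intro _ h
      refine ⟨0, ?_, ?_⟩
      · simp [h]
      · intro b; simp [cntG, h]
    · intro _ h
      refine ⟨0, 0, ?_, ?_, ?_⟩
      · simp [h]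
      · simp [h]
      · simp [cntG]
  | succ k ih =>
    intro w
    obtain ⟨i1, i2, i3, i4⟩ := ih (Fin.tail w)
    have hl : List.ofFn (Fin.tail w) = w 1 :: List.ofFn (Fin.tail (Fin.tail w)) := by
      rw [List.ofFn_succ]; rfl
    have hl2 : ∃ x xs, List.ofFn (Fin.tail (Fin.tail w)) = x :: xs := by
      rw [List.ofFn_succ]; exact ⟨_, _, rfl⟩
    have hG : ∀ b, cntG t b (w 0) (List.ofFn (Fin.tail w)) =
        (if w 0 ≤ w 1 ∧ b = false then 0 else
          cntG t false (w 1) (List.ofFn (Fin.tail (Fin.tail w)))) +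
        t * (if w 0 ≤ w 1 then 0 else cntG t true (w 1) (List.ofFn (Fin.tail (Fin.tail w)))) := by
      intro b
      obtain ⟨x, xs, hx⟩ := hl2
      rw [hl, hx, cntG]
      simp
    have e0 : Fin.tail w 0 = w 1 := rfl
    have e1 : Fin.tail w 1 = w 2 := rfl
    have ek : Fin.tail w ⟨k, by omega⟩ = w ⟨k + 1, by omega⟩ := rfl
    have ek1 : Fin.tail w ⟨k + 1, by omega⟩ = w ⟨k + 1 + 1, by omega⟩ := rfl
    rw [e0] at i1
    rw [e0, e1] at i2 i3 i4
    rw [ek, ek1] at i3 i4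
    rw [ascF_succ, ndaF_succ]
    simp only [hG]
    refine ⟨?_, ?_, ?_, ?_⟩
    · intro hnd b
      by_cases h2 : NDAF (Fin.tail w)
      · have h3 : w 0 ≤ w 1 ∧ w 1 ≤ w 2 := by
          by_contra hh; exact hnd ⟨hh, h2⟩
        simp [-List.ofFn_succ, h3.1, i2 h3.2]
      · simp [-List.ofFn_succ, i1 h2]
    · intro h
      simp [h]
    · rintro ⟨-, h2⟩ h
      by_cases h3 : w 1 ≤ w 2
      · obtain ⟨e, B, hB, he, hc⟩ := i4 h2 h3
        refine ⟨e, ?_, fun b => ?_⟩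
        · simp only [h, if_false]; omega
        · simp only [h, if_false, false_and, hc, i2 h3, hB]; ring
      · obtain ⟨e, he, hc⟩ := i3 h2 h3
        refine ⟨e + 1, ?_, fun b => ?_⟩
        · simp only [h, if_false]; omega
        · simp only [h, if_false, false_and, hc]; ring
    · rintro ⟨h1, h2⟩ h
      have h3 : ¬ w 1 ≤ w 2 := fun h3 => h1 ⟨h, h3⟩
      obtain ⟨e, he, hc⟩ := i3 h2 h3
      refine ⟨e, ascF (Fin.tail w), ?_, ?_, ?_⟩
      · simp only [h, if_true]; omega
      · simp only [h, if_true]; omega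
      · simp [-List.ofFn_succ, h, hc]

end ClosedForm

section Main

universe u

theorem isMaximalChain_iff {X : Type*} [PartialOrder X] [OrderBot X] [OrderTop X] (l : List X) :
    IsMaximalChain l ↔ List.IsChain (· ⋖ ·) l ∧ l.head? = some ⊥ ∧ l.getLast? = some ⊤ := by
  constructor
  · rintro ⟨h1, -, h3, h4, h5⟩
    refine ⟨List.IsChain.imp (fun a b h => covIn_univ_iff.1 h) h3, ?_, ?_⟩
    · obtain ⟨x, hx⟩ : ∃ x, l.head? = some x := by
        cases l with
        | nil => exact absurd rfl h1
        | cons a l => exact ⟨a, rfl⟩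
      have := h4 x hx ⊥ trivial
      rw [bot_lt_iff_ne_bot, not_not] at this
      rw [hx, this]
    · obtain ⟨x, hx⟩ : ∃ x, l.getLast? = some x := ⟨_, List.getLast?_eq_some_getLast h1⟩
      have := h5 x hx ⊤ trivial
      rw [lt_top_iff_ne_top, not_not] at this
      rw [hx, this]
  · rintro ⟨h1, h2, h3⟩
    refine ⟨by rintro rfl; simp at h2, fun _ _ => trivial,
      List.IsChain.imp (fun a b h => covIn_univ_iff.2 h) h1, ?_, ?_⟩
    · intro x hx c _ hc
      rw [h2] at hx
      cases hx
      exact not_lt_bot hc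
    · intro x hx c _ hc
      rw [h3] at hx
      cases hx
      exact not_top_lt hc

theorem labelSeq_length {X L : Type*} (lab : X → X → L) (l : List X) :
    (labelSeq lab l).length = l.length - 1 := by
  simp [labelSeq]

variable {α : Type*} [PartialOrder α] [Fintype α] {rP : α → ℕ} {t n : ℕ}

/-- The total count above a label word. -/
noncomputable def cntK {L : Type*} [PartialOrder L] (t : ℕ) : List L → ℕ
  | [] => 0
  | a :: ws => cntG t false a ws

theorem card_fiber {L : Type*} [PartialOrder L] [Nonempty α] (hrP : IsRankFunction rP)
    (hlen : HasLength α n)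
    (lab : WithBot (WithTop α) → WithBot (WithTop α) → L) (m : ℕ)
    (c : List (WithBot (WithTop α))) (hc : IsMaximalChain c) (hcl : c.length = m + 3) :
    Nat.card {l : List (WithBot (WithTop (Rees rP (rankT t n)))) //
        (IsMaximalChain l ∧
          AscentFree (reesLab rP (rankT t n) lab (fun _ _ => (PUnit.unit : PUnit.{u + 1}))) l ∧
          l.length = m + 3) ∧ l.map reesFst = c} = cntK t (labelSeq lab c) := by
  rw [isMaximalChain_iff] at hc
  obtain ⟨hc1, hc2, hc3⟩ := hc
  match c, hcl, hc1, hc2, hc3 with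
  | x :: y :: d :: cs, hcl, hc1, hc2, hc3 =>
    simp only [List.head?_cons, Option.some.injEq] at hc2
    subst hc2
    rw [List.isChain_cons_cons] at hc1
    obtain ⟨p, rfl⟩ : ∃ p, y = hatc p := by
      rcases hat_cases y with rfl | rfl | h
      · exact absurd hc1.1.lt not_lt_bot
      · exact absurd (List.isChain_cons_cons.1 hc1.2).1 hat_top_not_covBy
      · exact h
    have hp : IsMin p := hat_bot_covBy.1 hc1.1
    let z : Rees rP (rankT t n) := ⟨(p, ⊥), by simp only [rankT]; exact Nat.zero_le _⟩
    have hlast : (d :: cs).getLast? = some ⊤ := by simpa using hc3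
    have hfib := card_fib.{u} hrP hlen lab (d :: cs) z (lab ⊥ (hatc p)) false hc1.2 hlast
    have hz : IsMin z := (Rees.isMin_iff hrP).2 hp
    refine Eq.trans ?_ hfib
    symm
    refine Nat.card_congr (Equiv.ofBijective
      (fun x => ⟨⊥ :: hatc z :: x.1, ⟨?_, ?_, ?_⟩, ?_⟩) ⟨?_, ?_⟩)
    · obtain ⟨l, h1, h2, h3⟩ := x
      rw [isMaximalChain_iff, List.isChain_cons_cons]
      refine ⟨⟨hat_bot_covBy.2 hz, h2⟩, rfl, ?_⟩
      have hl : (l.getLast?).map reesFst = some ⊤ := by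
        rw [← List.getLast?_map, h1, hlast]
      rw [Option.map_eq_some_iff] at hl
      obtain ⟨a, ha, ha'⟩ := hl
      rw [reesFst_eq_top] at ha'
      subst ha'
      simp [List.getLast?_cons, ha]
    · obtain ⟨l, h1, h2, h3⟩ := x
      unfold AscentFree
      rw [labelSeq_cons_cons, lab_bot _ _ rfl]
      exact h3
    · have := congrArg List.length x.2.1
      simp at this hcl ⊢
      omega
    · simp only [List.map_cons, x.2.1, reesFst_bot]
      rfl
    · intro x y hxy
      have := congrArg Subtype.val hxy
      simp only [List.cons.injEq, true_and] at this
      exact Subtype.ext this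
    · rintro ⟨l, ⟨h1, h2, h3⟩, h4⟩
      obtain ⟨x, l, rfl, hx, hl⟩ := List.map_eq_cons_iff.1 h4
      obtain ⟨y, l, rfl, hy, hl'⟩ := List.map_eq_cons_iff.1 hl
      rw [reesFst_eq_bot] at hx
      subst hx
      rw [isMaximalChain_iff, List.isChain_cons_cons] at h1
      obtain ⟨y, rfl⟩ : ∃ y', y = hatc y' := by
        rcases hat_cases y with rfl | rfl | h
        · exact absurd h1.1.1.lt not_lt_bot
        · exact absurd hy.symm (hatc_ne_top _)
        · exact h
      have hy' : y.1.1 = p := WithTop.coe_injective (WithBot.coe_injective hy)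
      have hyz : y = z := by
        refine Subtype.ext (Prod.ext hy' (Subtype.ext ?_))
        have h5 := y.2
        rw [hy', rank_isMin hrP hp] at h5
        exact List.eq_nil_of_length_eq_zero (Nat.le_zero.1 h5)
      subst hyz
      unfold AscentFree at h2
      rw [labelSeq_cons_cons, lab_bot _ _ rfl] at h2
      exact ⟨⟨l, hl', h1.1.2, h2⟩, rfl⟩

theorem card_main {L : Type*} [PartialOrder L] [Fintype L] [Nonempty α]
    (hrP : IsRankFunction rP) (hlen : HasLength α n)
    (lab : WithBot (WithTop α) → WithBot (WithTop α) → L) (m : ℕ) :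
    Nat.card {l : List (WithBot (WithTop (Rees rP (rankT t n)))) //
        IsMaximalChain l ∧
          AscentFree (reesLab rP (rankT t n) lab (fun _ _ => (PUnit.unit : PUnit.{u + 1}))) l ∧
          l.length = m + 3} =
      ∑ w : Fin (m + 2) → L,
          Nat.card {l : List (WithBot (WithTop α)) // IsMaximalChain l ∧
              l.length = m + 3 ∧ labelSeq lab l = List.ofFn w} *
            cntG t false (w 0) (List.ofFn (Fin.tail w)) := by
  have hfin1 : Finite (WithBot (WithTop (Rees rP (rankT t n)))) :=
    inferInstanceAs (Finite (Option (Option _)))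
  have hfin2 : Finite (WithBot (WithTop α)) :=
    inferInstanceAs (Finite (Option (Option _)))
  let S := {l : List (WithBot (WithTop (Rees rP (rankT t n)))) //
        IsMaximalChain l ∧
          AscentFree (reesLab rP (rankT t n) lab (fun _ _ => (PUnit.unit : PUnit.{u + 1}))) l ∧
          l.length = m + 3}
  let C := {l : List (WithBot (WithTop α)) // IsMaximalChain l ∧ l.length = m + 3}
  have : Finite S := finite_lists _ _ (m + 3) (fun l h => h.2.2)
  have : Finite C := finite_lists _ _ (m + 3) (fun l h => h.2)
  have : Fintype C := Fintype.ofFinite C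
  let f : S → C := fun s => ⟨s.1.map reesFst, by
    obtain ⟨l, h1, h2, h3⟩ := s
    rw [isMaximalChain_iff] at h1 ⊢
    refine ⟨⟨?_, ?_, ?_⟩, by simpa using h3⟩
    · rw [List.isChain_map]
      exact List.IsChain.imp (fun a b h => reesFst_covBy hrP h) h1.1
    · rw [List.head?_map, h1.2.1]; rfl
    · rw [List.getLast?_map, h1.2.2]; rfl⟩
  have hS : Nat.card S = ∑ c : C, cntK t (labelSeq lab c.1) := by
    rw [← Nat.card_congr (Equiv.sigmaFiberEquiv f), Nat.card_sigma]
    refine Finset.sum_congr rfl fun c _ => ?_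
    rw [← card_fiber.{u} hrP hlen lab m c.1 c.2.1 c.2.2]
    refine Nat.card_congr ?_
    refine (Equiv.subtypeEquivRight (q := fun s : S => s.1.map reesFst = c.1) ?_).trans ?_
    · intro s; exact Subtype.ext_iff
    · exact Equiv.subtypeSubtypeEquivSubtypeInter _
        (fun l : List (WithBot (WithTop (Rees rP (rankT t n)))) => l.map reesFst = c.1)
  have hlenC : ∀ c : C, (labelSeq lab c.1).length = m + 2 := by
    intro c; rw [labelSeq_length, c.2.2]; rfl
  let g : C → (Fin (m + 2) → L) := fun c i => (labelSeq lab c.1)[(i : ℕ)]'(by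
    rw [hlenC]; exact i.2)
  have hg : ∀ c w, g c = w ↔ labelSeq lab c.1 = List.ofFn w := by
    intro c w
    constructor
    · rintro rfl
      apply List.ext_getElem
      · simp [hlenC]
      · intro i h1 h2
        simp [g, -List.ofFn_succ]
    · intro h
      funext i
      simp only [g]
      simp [h, -List.ofFn_succ]
  change Nat.card S = _
  rw [hS, ← Finset.sum_fiberwise Finset.univ g]
  refine Finset.sum_congr rfl fun w _ => ?_
  have hK : cntK t (List.ofFn w) = cntG t false (w 0) (List.ofFn (Fin.tail w)) := by
    rw [List.ofFn_succ]; rfl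
  rw [← hK]
  rw [Finset.sum_congr rfl (g := fun _ => cntK t (List.ofFn w))]
  · rw [Finset.sum_const, smul_eq_mul]
    congr 1
    rw [← Fintype.card_subtype, ← Nat.card_eq_fintype_card]
    refine Nat.card_congr ?_
    refine (Equiv.subtypeEquivRight (q := fun c : C => labelSeq lab c.1 = List.ofFn w) ?_).trans
      ((Equiv.subtypeSubtypeEquivSubtypeInter _
        (fun l : List (WithBot (WithTop α)) => labelSeq lab l = List.ofFn w)).trans ?_)
    · intro c; exact hg c w
    · exact Equiv.subtypeEquivRight (fun l => and_assoc)
  · intro c hc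
    simp only [Finset.mem_filter, Finset.mem_univ, true_and] at hc
    rw [(hg c w).1 hc]

end Main

/-- Linusson–Shareshian–Wachs. Let `P` be a finite semipure poset of
length `n` and `λ_P` an EL-labeling of `P̂`; let `λ` be the Rees-product EL-labeling of
`(P ∗ T_{t,n})^` built from `λ_P` and the constant semi-EL-labeling of `T_{t,n}`.
For `m ∈ ℕ`, the number of ascent-free maximal chains of `(P ∗ T_{t,n})^` of length
`m + 2` (i.e. with `m + 3` elements) equals the sum over all `w ∈ L_P^{m+2}` with no
double ascent, `w₁ ≰ w₂` and `w_{m+1} ≰ w_{m+2}` of `c(w) t^{asc w} (1+t)^{m - 2 asc w}`,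
plus the sum over all `w ∈ L_P^{m+2}` with no double ascent, `w₁ ≰ w₂` and
`w_{m+1} ≤ w_{m+2}` of `c(w) t^{asc w} (1+t)^{m+1-2 asc w}`, where `c(w)` is the number
of maximal chains of `P̂` of length `m + 2` with label sequence `w`. -/
theorem statement_2 {α L : Type*} [PartialOrder α] [Fintype α]
    [PartialOrder L] [Fintype L]
    (t n : ℕ) (ht : 0 < t) (hn : 0 < n)
    (rP : α → ℕ) (hrP : IsRankFunction rP) (hlen : HasLength α n)
    (lab : WithBot (WithTop α) → WithBot (WithTop α) → L)
    (hEL : IsELLabeling lab) (m : ℕ) :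
    Nat.card {l : List (WithBot (WithTop (Rees rP (rankT t n)))) //
        IsMaximalChain l ∧
          AscentFree (reesLab rP (rankT t n) lab (fun _ _ => PUnit.unit)) l ∧
          l.length = m + 3} =
      (∑ w : Fin (m + 2) → L,
        if NDAF w ∧ ¬w ⟨0, by omega⟩ ≤ w ⟨1, by omega⟩ ∧
            ¬w ⟨m, by omega⟩ ≤ w ⟨m + 1, by omega⟩ then
          Nat.card {l : List (WithBot (WithTop α)) // IsMaximalChain l ∧
              l.length = m + 3 ∧ labelSeq lab l = List.ofFn w} *
            t ^ ascF w * (1 + t) ^ (m - 2 * ascF w)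
        else 0) +
      ∑ w : Fin (m + 2) → L,
        if NDAF w ∧ ¬w ⟨0, by omega⟩ ≤ w ⟨1, by omega⟩ ∧
            w ⟨m, by omega⟩ ≤ w ⟨m + 1, by omega⟩ then
          Nat.card {l : List (WithBot (WithTop α)) // IsMaximalChain l ∧
              l.length = m + 3 ∧ labelSeq lab l = List.ofFn w} *
            t ^ ascF w * (1 + t) ^ (m + 1 - 2 * ascF w)
        else 0 := by
  have hne : Nonempty α := by
    obtain ⟨l, -, hl⟩ := hlen.1
    cases l with
    | nil => simp at hl
    | cons a l => exact ⟨a⟩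
  rw [card_main hrP hlen lab m, ← Finset.sum_add_distrib]
  refine Finset.sum_congr rfl fun w _ => ?_
  obtain ⟨h1, h2, h3, -⟩ := cntG_closed t m w
  have e0 : w ⟨0, by omega⟩ = w 0 := rfl
  have e1 : w ⟨1, by omega⟩ = w 1 := rfl
  rw [e0, e1]
  by_cases hn : NDAF w
  · by_cases ha : w 0 ≤ w 1
    · simp [-List.ofFn_succ, ha, h2 ha]
    · obtain ⟨e, he, hc⟩ := h3 hn ha
      rw [hc]
      by_cases hl : w ⟨m, by omega⟩ ≤ w ⟨m + 1, by omega⟩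
      · simp only [hl, if_true] at he
        have : m + 1 - 2 * ascF w = e := by omega
        simp only [hn, ha, hl, not_true_eq_false, and_false, if_false, not_false_eq_true,
          and_self, if_true, this]
        ring
      · simp only [hl, if_false] at he
        have : m - 2 * ascF w = e := by omega
        simp only [hn, ha, hl, and_false, if_false, not_false_eq_true,
          and_self, if_true, this]
        ring
  · simp [-List.ofFn_succ, hn, h1 hn]
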